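/- arXiv:2603.07094 — 2 statements merged into one kernel-verified Lean document; each statement's English description precedes it below -/
import Mathlib

section
/- For every ε > 0, there exists a memoryless collective strategy σ̄ for the team such that, for every state s and every opponent strategy, the probability of reaching the target set T from s under the resulting strategy profile is at least w(s) − ε, where w denotes the pointwise limit of the value iteration sequence. -/
/-!
Common framework: team concurrent stochastic reachability games.
-/

noncomputable section

/-- A concurrent game structure: finitely many players, finitely many states,
finitely many actions per player, available actions, and a probabilistic
transition function. -/
structure GameStructure where
  Player : Type
  [playerFin : Fintype Player]
  [playerDec : DecidableEq Player]
  State : Type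
  [stateFin : Fintype State]
  [stateDec : DecidableEq State]
  Act : Player → Type
  [actFin : ∀ p, Fintype (Act p)]
  [actDec : ∀ p, DecidableEq (Act p)]
  Av : (p : Player) → State → Finset (Act p)
  av_nonempty : ∀ p s, (Av p s).Nonempty
  trans : State → ((p : Player) → Act p) → State → ℝ
  trans_nonneg : ∀ s a t, 0 ≤ trans s a t
  trans_sum : ∀ s a, ∑ t, trans s a t = 1

attribute [instance] GameStructure.playerFin GameStructure.playerDec
  GameStructure.stateFin GameStructure.stateDec GameStructure.actFin GameStructure.actDec

/-- A (behavioural) strategy of player `p`: a distribution over available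
actions, for every history `h` (the list of previously visited states)
and current state `s`. -/
structure Strategy (G : GameStructure) (p : G.Player) where
  toFun : List G.State → G.State → G.Act p → ℝ
  nonneg : ∀ h s a, 0 ≤ toFun h s a
  support_av : ∀ h s a, a ∉ G.Av p s → toFun h s a = 0
  sum_one : ∀ h s, ∑ a, toFun h s a = 1

/-- A strategy is memoryless if it only depends on the current state. -/
def Strategy.Memoryless {G : GameStructure} {p : G.Player} (σ : Strategy G p) : Prop :=
  ∀ h h' s, σ.toFun h s = σ.toFun h' s

/-- A strategy is deterministic if it always plays a single action with probability 1. -/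
def Strategy.Deterministic {G : GameStructure} {p : G.Player} (σ : Strategy G p) : Prop :=
  ∀ h s, ∃ a, σ.toFun h s a = 1

/-- A selector of player `p` at state `s`: a distribution over the available actions. -/
structure Selector (G : GameStructure) (p : G.Player) (s : G.State) where
  toFun : G.Act p → ℝ
  nonneg : ∀ a, 0 ≤ toFun a
  support_av : ∀ a, a ∉ G.Av p s → toFun a = 0
  sum_one : ∑ a, toFun a = 1

/-- A game: a game structure together with a team, an absorbing target set,
and an initial state. -/
structure Game extends GameStructure where
  team : Finset Player
  target : Finset State
  init : State
  absorbing : ∀ t ∈ target, ∀ a, trans t a t = 1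

namespace Game

variable (Gm : Game)

abbrev TeamPlayer := {p : Gm.Player // p ∈ Gm.team}
abbrev OppPlayer := {p : Gm.Player // p ∉ Gm.team}

/-- A collective strategy: one strategy for each team player. -/
abbrev TeamStrategy := (p : Gm.TeamPlayer) → Strategy Gm.toGameStructure p.1
/-- An opponent strategy: one strategy for each player outside the team. -/
abbrev OppStrategy := (p : Gm.OppPlayer) → Strategy Gm.toGameStructure p.1

abbrev TeamAct := (p : Gm.TeamPlayer) → Gm.Act p.1
abbrev OppAct := (p : Gm.OppPlayer) → Gm.Act p.1

/-- A collective selector at state `s`. -/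
abbrev TeamSelector (s : Gm.State) := (p : Gm.TeamPlayer) → Selector Gm.toGameStructure p.1 s

def MemorylessTeam (σ : Gm.TeamStrategy) : Prop := ∀ p, (σ p).Memoryless
def DeterministicTeam (σ : Gm.TeamStrategy) : Prop := ∀ p, (σ p).Deterministic
def MemorylessOpp (τ : Gm.OppStrategy) : Prop := ∀ p, (τ p).Memoryless

/-- Combine a collective strategy and an opponent strategy into a full profile. -/
def combine (σ : Gm.TeamStrategy) (τ : Gm.OppStrategy) (p : Gm.Player) :
    Strategy Gm.toGameStructure p :=
  if h : p ∈ Gm.team then σ ⟨p, h⟩ else τ ⟨p, h⟩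

/-- Combine a joint team action and a joint opponent action into a full action profile. -/
def combineAct (a : Gm.TeamAct) (b : Gm.OppAct) (p : Gm.Player) : Gm.Act p :=
  if h : p ∈ Gm.team then a ⟨p, h⟩ else b ⟨p, h⟩

/-- A joint opponent action is available at `s`. -/
def OppAvailable (s : Gm.State) (b : Gm.OppAct) : Prop := ∀ p, b p ∈ Gm.Av p.1 s

/-- One-step transition probability, under a full strategy profile, from state `s`
with history `h`, to state `t` (players randomise independently). -/
def stepProb (π : (p : Gm.Player) → Strategy Gm.toGameStructure p)
    (h : List Gm.State) (s t : Gm.State) : ℝ :=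
  ∑ a : (p : Gm.Player) → Gm.Act p, (∏ p, (π p).toFun h s (a p)) * Gm.trans s a t

/-- Probability of visiting the target within `n` steps, starting at state `s`
with history `h`. -/
def reachWithin (π : (p : Gm.Player) → Strategy Gm.toGameStructure p) :
    ℕ → List Gm.State → Gm.State → ℝ
  | 0, _, s => if s ∈ Gm.target then 1 else 0
  | n + 1, h, s =>
      if s ∈ Gm.target then 1
      else ∑ t, Gm.stepProb π h s t * reachWithin π n (h ++ [s]) t

/-- Probability of eventually reaching the target set, starting from state `s`. -/
def reachProbFrom (π : (p : Gm.Player) → Strategy Gm.toGameStructure p) (s : Gm.State) : ℝ :=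
  ⨆ n : ℕ, Gm.reachWithin π n [] s

/-- Probability of eventually reaching the target set from the initial state. -/
def reachProb (π : (p : Gm.Player) → Strategy Gm.toGameStructure p) : ℝ :=
  Gm.reachProbFrom π Gm.init

/-- Probability of visiting the target set for the first time exactly at step `k`. -/
def firstHit (π : (p : Gm.Player) → Strategy Gm.toGameStructure p) :
    ℕ → List Gm.State → Gm.State → ℝ
  | 0, _, s => if s ∈ Gm.target then 1 else 0
  | k + 1, h, s =>
      if s ∈ Gm.target then 0
      else ∑ t, Gm.stepProb π h s t * firstHit π k (h ++ [s]) t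

/-- Expected `lam`-discounted payoff from the initial state: the play pays `lam ^ k`
if it first visits the target at step `k`, and `0` if it never visits the target. -/
def discounted (π : (p : Gm.Player) → Strategy Gm.toGameStructure p) (lam : ℝ) : ℝ :=
  ∑' k : ℕ, lam ^ k * Gm.firstHit π k [] Gm.init

/-- A play (an infinite sequence of states from the initial state) is compatible with
a strategy profile if each of its transitions occurs with positive probability. -/
def CompatiblePlay (π : (p : Gm.Player) → Strategy Gm.toGameStructure p)
    (play : ℕ → Gm.State) : Prop :=
  play 0 = Gm.init ∧
  ∀ n, 0 < Gm.stepProb π (List.ofFn fun i : Fin n => play i.1) (play n) (play (n + 1))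

/-- Expected value of the valuation `v` at the successor of `s`, when the team plays
according to the collective selector `ξ` and the opponent plays the joint action `b`. -/
def preTeamAct (v : Gm.State → ℝ) (s : Gm.State) (ξ : Gm.TeamSelector s) (b : Gm.OppAct) : ℝ :=
  ∑ a : Gm.TeamAct, (∏ p, (ξ p).toFun (a p)) * ∑ t, Gm.trans s (Gm.combineAct a b) t * v t

/-- An opponent selector at state `s`: a distribution over available joint opponent actions. -/
structure OppSelector (s : Gm.State) where
  toFun : Gm.OppAct → ℝ
  nonneg : ∀ b, 0 ≤ toFun b
  support_av : ∀ b, ¬ Gm.OppAvailable s b → toFun b = 0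
  sum_one : ∑ b, toFun b = 1

/-- Expected value of `v` at the successor of `s` under a collective selector `ξ`
and an opponent selector `ζ`. -/
def preSel (v : Gm.State → ℝ) (s : Gm.State) (ξ : Gm.TeamSelector s) (ζ : Gm.OppSelector s) : ℝ :=
  ∑ b, ζ.toFun b * Gm.preTeamAct v s ξ b

/-- The predecessor operator: best one-step value the team can guarantee. -/
def pre (v : Gm.State → ℝ) (s : Gm.State) : ℝ :=
  ⨆ ξ : Gm.TeamSelector s, ⨅ ζ : Gm.OppSelector s, Gm.preSel v s ξ ζ

/-- The value iteration sequence: `vIter 0` is the indicator of the target set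
and `vIter (n+1) = pre (vIter n)`. -/
def vIter : ℕ → Gm.State → ℝ
  | 0 => fun s => if s ∈ Gm.target then 1 else 0
  | n + 1 => Gm.pre (vIter n)

/-- The max-min value of the game started at `s`. -/
def maxminFrom (s : Gm.State) : ℝ :=
  ⨆ σ : Gm.TeamStrategy, ⨅ τ : Gm.OppStrategy, Gm.reachProbFrom (Gm.combine σ τ) s

/-- The set of states from which the team can win almost surely. -/
def winSet : Set Gm.State :=
  {s | ∃ σ : Gm.TeamStrategy, ∀ τ : Gm.OppStrategy, Gm.reachProbFrom (Gm.combine σ τ) s = 1}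

/-- Distribution of the successor of `s` when the team plays the collective
selector `ξ` and the opponent plays the joint action `b`. -/
def succProbSel (s : Gm.State) (ξ : Gm.TeamSelector s) (b : Gm.OppAct) (t : Gm.State) : ℝ :=
  ∑ a : Gm.TeamAct, (∏ p, (ξ p).toFun (a p)) * Gm.trans s (Gm.combineAct a b) t

/-- Distribution of the successor of `s` (with history `h`) when the team plays the
collective strategy `σ` and the opponent plays the joint action `b`. -/
def succProbTeam (σ : Gm.TeamStrategy) (h : List Gm.State) (s : Gm.State)
    (b : Gm.OppAct) (t : Gm.State) : ℝ :=
  ∑ a : Gm.TeamAct, (∏ p, (σ p).toFun h s (a p)) * Gm.trans s (Gm.combineAct a b) t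

/-- The layered decomposition of the almost-sure winning set. -/
def wSeq : ℕ → Set Gm.State
  | 0 => ↑Gm.target
  | k + 1 =>
      wSeq k ∪
      {s ∈ Gm.winSet | ∃ ξ : Gm.TeamSelector s, ∀ b : Gm.OppAct, Gm.OppAvailable s b →
        (0 < ∑ t, (wSeq k).indicator (Gm.succProbSel s ξ b) t) ∧
        (∑ t, Gm.winSet.indicator (Gm.succProbSel s ξ b) t = 1)}

end Game

namespace Game

variable {Gm : Game}

theorem sum_prod_teamSelector {s : Gm.State} (ξ : Gm.TeamSelector s) :
    ∑ a : Gm.TeamAct, ∏ p, (ξ p).toFun (a p) = 1 := by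
  rw [← Fintype.piFinset_univ, ← Finset.prod_univ_sum]
  exact Finset.prod_eq_one fun p _ => (ξ p).sum_one

theorem preTeamAct_le_add {u v : Gm.State → ℝ} {c : ℝ} (h : ∀ t, v t ≤ u t + c)
    {s : Gm.State} (ξ : Gm.TeamSelector s) (b : Gm.OppAct) :
    Gm.preTeamAct v s ξ b ≤ Gm.preTeamAct u s ξ b + c := by
  have hstep (a : Gm.TeamAct) : ∑ t, Gm.trans s (Gm.combineAct a b) t * v t ≤
      ∑ t, Gm.trans s (Gm.combineAct a b) t * u t + c := by
    calc _ ≤ ∑ t, Gm.trans s (Gm.combineAct a b) t * (u t + c) :=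
          Finset.sum_le_sum fun t _ => mul_le_mul_of_nonneg_left (h t) (Gm.trans_nonneg _ _ _)
      _ = _ := by
          simp only [mul_add, Finset.sum_add_distrib, ← Finset.sum_mul, Gm.trans_sum, one_mul]
  calc _ ≤ ∑ a : Gm.TeamAct, (∏ p, (ξ p).toFun (a p)) *
        (∑ t, Gm.trans s (Gm.combineAct a b) t * u t + c) :=
        Finset.sum_le_sum fun a _ => mul_le_mul_of_nonneg_left (hstep a)
          (Finset.prod_nonneg fun p _ => (ξ p).nonneg _)
    _ = _ := by
        simp only [mul_add, Finset.sum_add_distrib, ← Finset.sum_mul, sum_prod_teamSelector,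
          one_mul, preTeamAct]

theorem preSel_le_add {u v : Gm.State → ℝ} {c : ℝ} (h : ∀ t, v t ≤ u t + c)
    {s : Gm.State} (ξ : Gm.TeamSelector s) (ζ : Gm.OppSelector s) :
    Gm.preSel v s ξ ζ ≤ Gm.preSel u s ξ ζ + c := by
  calc _ ≤ ∑ b, ζ.toFun b * (Gm.preTeamAct u s ξ b + c) :=
        Finset.sum_le_sum fun b _ => mul_le_mul_of_nonneg_left (preTeamAct_le_add h ξ b)
          (ζ.nonneg b)
    _ = _ := by
        simp only [mul_add, Finset.sum_add_distrib, ← Finset.sum_mul, ζ.sum_one, one_mul, preSel]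

theorem preSel_zero {s : Gm.State} (ξ : Gm.TeamSelector s) (ζ : Gm.OppSelector s) :
    Gm.preSel (fun _ => 0) s ξ ζ = 0 := by
  simp [preSel, preTeamAct]

theorem preSel_mem_Icc {v : Gm.State → ℝ} (hv : ∀ t, v t ∈ Set.Icc (0 : ℝ) 1)
    {s : Gm.State} (ξ : Gm.TeamSelector s) (ζ : Gm.OppSelector s) :
    Gm.preSel v s ξ ζ ∈ Set.Icc (0 : ℝ) 1 := by
  constructor
  · simpa [preSel_zero] using preSel_le_add (u := v) (v := fun _ => 0) (c := 0)
      (fun t => by simpa using (hv t).1) ξ ζ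
  · simpa [preSel_zero] using preSel_le_add (u := fun _ => 0) (v := v) (c := 1)
      (fun t => by simpa using (hv t).2) ξ ζ

theorem bddBelow_range_preSel {v : Gm.State → ℝ} (hv : ∀ t, v t ∈ Set.Icc (0 : ℝ) 1)
    {s : Gm.State} (ξ : Gm.TeamSelector s) :
    BddBelow (Set.range fun ζ : Gm.OppSelector s => Gm.preSel v s ξ ζ) :=
  ⟨0, by rintro _ ⟨ζ, rfl⟩; exact (preSel_mem_Icc hv ξ ζ).1⟩

/-- The joint distribution of the independent choices of the opponents at a given history. -/
def OppStrategy.oppSelector (τ : Gm.OppStrategy) (h : List Gm.State) (s : Gm.State) :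
    Gm.OppSelector s where
  toFun b := ∏ p, (τ p).toFun h s (b p)
  nonneg b := Finset.prod_nonneg fun p _ => (τ p).nonneg _ _ _
  support_av b hb := by
    simp only [OppAvailable, not_forall] at hb
    obtain ⟨p, hp⟩ := hb
    exact Finset.prod_eq_zero (Finset.mem_univ p) ((τ p).support_av _ _ _ hp)
  sum_one := by
    rw [← Fintype.piFinset_univ, ← Finset.prod_univ_sum]
    exact Finset.prod_eq_one fun p _ => (τ p).sum_one _ _

/-- The uniform strategy over the available actions. -/
def uniformStrategy (p : Gm.Player) : Strategy Gm.toGameStructure p where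
  toFun _ s a := if a ∈ Gm.Av p s then ((Gm.Av p s).card : ℝ)⁻¹ else 0
  nonneg _ s a := by split_ifs <;> positivity
  support_av _ s a ha := if_neg ha
  sum_one _ s := by
    have : ((Gm.Av p s).card : ℝ) ≠ 0 := by
      exact_mod_cast (Gm.av_nonempty p s).card_pos.ne'
    simp [this]

/-- The selector played by a strategy at a given history. -/
def _root_.Strategy.selector {G : GameStructure} {p : G.Player} (σ : Strategy G p)
    (h : List G.State) (s : G.State) : Selector G p s where
  toFun := σ.toFun h s
  nonneg := σ.nonneg h s
  support_av := σ.support_av h s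
  sum_one := σ.sum_one h s

instance (s : Gm.State) : Nonempty (Gm.TeamSelector s) :=
  ⟨fun p => (uniformStrategy p.1).selector [] s⟩

instance (s : Gm.State) : Nonempty (Gm.OppSelector s) :=
  ⟨OppStrategy.oppSelector (fun p => uniformStrategy p.1) [] s⟩

theorem iInf_preSel_le_one {v : Gm.State → ℝ} (hv : ∀ t, v t ∈ Set.Icc (0 : ℝ) 1)
    {s : Gm.State} (ξ : Gm.TeamSelector s) : ⨅ ζ, Gm.preSel v s ξ ζ ≤ 1 :=
  ciInf_le_of_le (bddBelow_range_preSel hv ξ) (Classical.arbitrary _) (preSel_mem_Icc hv ξ _).2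

theorem pre_mem_Icc {v : Gm.State → ℝ} (hv : ∀ t, v t ∈ Set.Icc (0 : ℝ) 1) (s : Gm.State) :
    Gm.pre v s ∈ Set.Icc (0 : ℝ) 1 :=
  ⟨Real.iSup_nonneg fun ξ => Real.iInf_nonneg fun ζ => (preSel_mem_Icc hv ξ ζ).1,
    ciSup_le fun ξ => iInf_preSel_le_one hv ξ⟩

theorem pre_le_add {u v : Gm.State → ℝ} (hu : ∀ t, u t ∈ Set.Icc (0 : ℝ) 1)
    (hv : ∀ t, v t ∈ Set.Icc (0 : ℝ) 1) {c : ℝ} (h : ∀ t, v t ≤ u t + c) (s : Gm.State) :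
    Gm.pre v s ≤ Gm.pre u s + c := by
  refine ciSup_le fun ξ => ?_
  have hinf : ⨅ ζ, Gm.preSel v s ξ ζ ≤ (⨅ ζ, Gm.preSel u s ξ ζ) + c := by
    rw [← sub_le_iff_le_add]
    refine le_ciInf fun ζ => ?_
    rw [sub_le_iff_le_add]
    exact (ciInf_le (bddBelow_range_preSel hv ξ) ζ).trans (preSel_le_add h ξ ζ)
  have hsup : ⨅ ζ, Gm.preSel u s ξ ζ ≤ Gm.pre u s :=
    le_ciSup (f := fun ξ : Gm.TeamSelector s => ⨅ ζ, Gm.preSel u s ξ ζ)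
      ⟨1, by rintro _ ⟨ξ, rfl⟩; exact iInf_preSel_le_one hu ξ⟩ ξ
  linarith

theorem vIter_mem_Icc (n : ℕ) (s : Gm.State) : Gm.vIter n s ∈ Set.Icc (0 : ℝ) 1 := by
  induction n generalizing s with
  | zero => simp only [vIter]; split_ifs <;> simp
  | succ n ih => exact pre_mem_Icc ih s

/-- Up to an arbitrarily small loss, each value iterate is dominated by a valuation that a fixed
choice of selectors makes strictly increase in expectation wherever it is positive outside
the target. -/
theorem exists_increasing_valuation {δ : ℝ} (hδ : 0 < δ) (n : ℕ) :
    ∃ (u : Gm.State → ℝ) (ξ : ∀ s, Gm.TeamSelector s),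
      (∀ s, u s ∈ Set.Icc (0 : ℝ) 1) ∧ (∀ s, Gm.vIter n s ≤ u s + n * δ) ∧
      ∀ s, s ∉ Gm.target → u s ≤ 0 ∨ ∀ ζ, u s + δ / 2 ≤ Gm.preSel u s (ξ s) ζ := by
  classical
  induction n with
  | zero =>
    refine ⟨Gm.vIter 0, fun _ => Classical.arbitrary _, vIter_mem_Icc 0, fun s => by simp, ?_⟩
    intro s hs
    simp [vIter, hs]
  | succ n ih =>
    obtain ⟨u, ξ, hu, hle, hinc⟩ := ih
    have hnear (s : Gm.State) :
        ∃ ξ' : Gm.TeamSelector s, ∀ ζ, Gm.pre u s - δ / 2 ≤ Gm.preSel u s ξ' ζ := by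
      obtain ⟨ξ', hξ'⟩ := exists_lt_of_lt_ciSup
        (show Gm.pre u s - δ / 2 < ⨆ ξ : Gm.TeamSelector s, ⨅ ζ, Gm.preSel u s ξ ζ by
          rw [← Game.pre]; linarith)
      exact ⟨ξ', fun ζ => hξ'.le.trans (ciInf_le (bddBelow_range_preSel hu ξ') ζ)⟩
    choose ξ' hξ' using hnear
    refine ⟨fun s => max (u s) (Gm.pre u s - δ),
      fun s => if Gm.pre u s - δ ≤ u s then ξ s else ξ' s, ?_, ?_, ?_⟩
    · intro s
      exact ⟨le_max_of_le_left (hu s).1,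
        max_le (hu s).2 (by linarith [(pre_mem_Icc hu s).2])⟩
    · intro s
      have h₁ : Gm.vIter (n + 1) s ≤ Gm.pre u s + n * δ := pre_le_add hu (vIter_mem_Icc n) hle s
      have h₂ := le_max_right (u s) (Gm.pre u s - δ)
      push_cast
      linarith
    · intro s hs
      have hmono (ξ₀ : Gm.TeamSelector s) (ζ : Gm.OppSelector s) : Gm.preSel u s ξ₀ ζ ≤
          Gm.preSel (fun s => max (u s) (Gm.pre u s - δ)) s ξ₀ ζ := by
        simpa using preSel_le_add (c := 0) (u := fun s => max (u s) (Gm.pre u s - δ)) (v := u)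
          (fun t => by simp) ξ₀ ζ
      by_cases hcase : Gm.pre u s - δ ≤ u s
      · simp only [hcase, if_true, max_eq_left]
        exact (hinc s hs).imp_right fun h ζ => (h ζ).trans (hmono _ ζ)
      · simp only [hcase, if_false, max_eq_right (not_le.1 hcase).le]
        exact Or.inr fun ζ => le_trans (by linarith [hξ' s ζ]) (hmono _ ζ)

theorem sum_stepProb_combine (σ : Gm.TeamStrategy) (τ : Gm.OppStrategy) (h : List Gm.State)
    (s : Gm.State) (f : Gm.State → ℝ) :
    ∑ t, Gm.stepProb (Gm.combine σ τ) h s t * f t =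
      Gm.preSel f s (fun p => (σ p).selector h s) (OppStrategy.oppSelector τ h s) := by
  have hprod (a : Gm.TeamAct) (b : Gm.OppAct) :
      ∏ p, (Gm.combine σ τ p).toFun h s (Gm.combineAct a b p) =
        (∏ p, (τ p).toFun h s (b p)) * ∏ p, (σ p).toFun h s (a p) := by
    rw [← Fintype.prod_subtype_mul_prod_subtype (fun p => p ∈ Gm.team), mul_comm]
    congr 1
    · exact Finset.prod_congr rfl fun p _ => by simp [combine, combineAct, p.2]
    · exact Finset.prod_congr (by ext; simp) fun p _ => by simp [combine, combineAct, p.2]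
  calc ∑ t, Gm.stepProb (Gm.combine σ τ) h s t * f t
      = ∑ a : (p : Gm.Player) → Gm.Act p, (∏ p, (Gm.combine σ τ p).toFun h s (a p)) *
          ∑ t, Gm.trans s a t * f t := by
        simp only [stepProb, Finset.sum_mul, Finset.mul_sum, mul_assoc]
        exact Finset.sum_comm
    _ = ∑ x : Gm.TeamAct × Gm.OppAct,
          (∏ p, (Gm.combine σ τ p).toFun h s (Gm.combineAct x.1 x.2 p)) *
            ∑ t, Gm.trans s (Gm.combineAct x.1 x.2) t * f t :=
        (Equiv.sum_comp (Equiv.piEquivPiSubtypeProd (fun p => p ∈ Gm.team) Gm.Act).symm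
          fun a => (∏ p, (Gm.combine σ τ p).toFun h s (a p)) * ∑ t, Gm.trans s a t * f t).symm
    _ = _ := by
        rw [Fintype.sum_prod_type_right]
        simp only [hprod, preSel, preTeamAct, Finset.mul_sum, mul_assoc]
        rfl

theorem reachWithin_combine_mem_Icc (σ : Gm.TeamStrategy) (τ : Gm.OppStrategy) (n : ℕ)
    (h : List Gm.State) (s : Gm.State) :
    Gm.reachWithin (Gm.combine σ τ) n h s ∈ Set.Icc (0 : ℝ) 1 := by
  induction n generalizing h s with
  | zero => simp only [reachWithin]; split_ifs <;> simp
  | succ n ih =>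
    simp only [reachWithin]
    split_ifs
    · simp
    · rw [sum_stepProb_combine]
      exact preSel_mem_Icc (ih _) _ _

theorem reachWithin_le_reachProbFrom (σ : Gm.TeamStrategy) (τ : Gm.OppStrategy) (n : ℕ)
    (s : Gm.State) :
    Gm.reachWithin (Gm.combine σ τ) n [] s ≤ Gm.reachProbFrom (Gm.combine σ τ) s :=
  le_ciSup (f := fun n => Gm.reachWithin (Gm.combine σ τ) n [] s)
    ⟨1, by rintro _ ⟨n, rfl⟩; exact (reachWithin_combine_mem_Icc σ τ n [] s).2⟩ n

/-- The memoryless collective strategy that plays a fixed collective selector in each state. -/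
def memorylessStrategy (ξ : ∀ s, Gm.TeamSelector s) : Gm.TeamStrategy := fun p =>
  { toFun := fun _ s => (ξ s p).toFun
    nonneg := fun _ s => (ξ s p).nonneg
    support_av := fun _ s => (ξ s p).support_av
    sum_one := fun _ s => (ξ s p).sum_one }

/-- If the expected value of `u` grows by at least `η` in each step spent outside the target
at a state where `u` is positive, then `u` is a lower bound for finite-horizon reachability, up to
an error that vanishes as soon as the horizon exceeds `1 / η`. -/
theorem le_reachWithin_combine {u : Gm.State → ℝ} (hu : ∀ s, u s ≤ 1) {η : ℝ} (hη : 0 ≤ η)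
    (σ : Gm.TeamStrategy)
    (hinc : ∀ h s, s ∉ Gm.target → u s ≤ 0 ∨
      ∀ ζ, u s + η ≤ Gm.preSel u s (fun p => (σ p).selector h s) ζ)
    (τ : Gm.OppStrategy) (n : ℕ) (h : List Gm.State) (s : Gm.State) :
    u s ≤ Gm.reachWithin (Gm.combine σ τ) n h s + max (1 - n * η) 0 := by
  induction n generalizing h s with
  | zero =>
    have := (reachWithin_combine_mem_Icc σ τ 0 h s).1
    simp only [Nat.cast_zero, zero_mul, sub_zero, max_eq_left zero_le_one]
    linarith [hu s]
  | succ n ih =>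
    have hmax := le_max_right (1 - ((n + 1 : ℕ) : ℝ) * η) 0
    by_cases hs : s ∈ Gm.target
    · simp only [reachWithin, hs, if_true]
      linarith [hu s]
    rcases hinc h s hs with hle | hstep
    · linarith [(reachWithin_combine_mem_Icc σ τ (n + 1) h s).1]
    · simp only [reachWithin, hs, if_false]
      rw [sum_stepProb_combine]
      have hpre := preSel_le_add (ih (h ++ [s])) (fun p => (σ p).selector h s)
        (OppStrategy.oppSelector τ h s)
      have := hstep (OppStrategy.oppSelector τ h s)
      have hdec : max (1 - (n : ℝ) * η) 0 ≤ max (1 - ((n + 1 : ℕ) : ℝ) * η) 0 + η := by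
        have hmax' := le_max_left (1 - ((n + 1 : ℕ) : ℝ) * η) 0
        refine max_le ?_ (by linarith)
        push_cast at hmax' ⊢
        linarith
      linarith

end Game

/-- For every `ε > 0` there is a *memoryless* collective strategy
guaranteeing, from every state `s` and against every opponent strategy, reaching
the target with probability at least `w s - ε`, where `w` is the pointwise limit
of the value iteration sequence. -/
theorem eps_optimal_memoryless_strategy_exists (Gm : Game) (w : Gm.State → ℝ)
    (hw : ∀ s, Filter.Tendsto (fun n => Gm.vIter n s) Filter.atTop (nhds (w s)))
    (ε : ℝ) (hε : 0 < ε) :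
    ∃ σ : Gm.TeamStrategy, Gm.MemorylessTeam σ ∧
      ∀ τ : Gm.OppStrategy, ∀ s : Gm.State,
        w s - ε ≤ Gm.reachProbFrom (Gm.combine σ τ) s := by
  obtain ⟨N, hN⟩ : ∃ N, ∀ s, w s - ε / 2 ≤ Gm.vIter N s :=
    (Filter.eventually_all.2 fun s =>
      (hw s).eventually_const_le (show w s - ε / 2 < w s by linarith)).exists
  obtain ⟨u, ξ, hu, hle, hinc⟩ :=
    Game.exists_increasing_valuation (Gm := Gm) (δ := ε / 2 / (N + 1)) (by positivity) N
  set δ := ε / 2 / ((N : ℝ) + 1) with hδ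
  have hδ0 : 0 < δ := by positivity
  have hNδ : (N : ℝ) * δ ≤ ε / 2 := by
    have : ((N : ℝ) + 1) * δ = ε / 2 := by rw [hδ]; field_simp
    linarith
  refine ⟨Game.memorylessStrategy ξ, fun _ _ _ _ => rfl, fun τ s => ?_⟩
  obtain ⟨M, hM⟩ := exists_nat_ge (1 / (δ / 2))
  have hMδ : 1 - (M : ℝ) * (δ / 2) ≤ 0 := by
    rw [div_le_iff₀ (by positivity)] at hM
    linarith
  have hreach := Game.le_reachWithin_combine (fun s => (hu s).2) (half_pos hδ0).le
    (Game.memorylessStrategy ξ) (fun _ s hs => hinc s hs) τ M [] s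
  rw [max_eq_right hMδ, add_zero] at hreach
  calc w s - ε ≤ u s := by linarith [hN s, hle s]
    _ ≤ _ := hreach
    _ ≤ _ := Game.reachWithin_le_reachProbFrom _ τ M s
end
end

section
/- Let W be the set of states from which the team has a collective strategy guaranteeing that T is reached with probability 1 against every opponent strategy. Define the nondecreasing sequence of sets W_0 ⊆ W_1 ⊆ … by W_0 = T and, for k ≥ 0, W_{k+1} = W_k ∪ {s ∈ W : there exists a collective selector at s such that for every opponent action available at s, the successor state lies in W_k with positive probability and lies in W with probability 1}. Then there exists m such that W_m = W. -/
/-!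
Common framework: team concurrent stochastic reachability games.
-/

noncomputable section

namespace Strategy

variable {G : GameStructure} {p : G.Player}

/-- The strategy that plays `choice h s` with probability one. -/
def pure (choice : List G.State → G.State → G.Act p) (hc : ∀ h s, choice h s ∈ G.Av p s) :
    Strategy G p where
  toFun h s a := if a = choice h s then 1 else 0
  nonneg h s a := by split_ifs <;> norm_num
  support_av h s a ha := if_neg fun e : a = choice h s => ha (e ▸ hc h s)
  sum_one h s := by simp

/-- The strategy that follows `σ`, reading every history through `f`. -/
def comapHistory (σ : Strategy G p) (f : List G.State → List G.State) : Strategy G p where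
  toFun h := σ.toFun (f h)
  nonneg h := σ.nonneg (f h)
  support_av h := σ.support_av (f h)
  sum_one h := σ.sum_one (f h)

/-- The strategy that follows `ρ` at histories of length `n` and `τ` elsewhere. -/
def switchAt (τ ρ : Strategy G p) (n : ℕ) : Strategy G p where
  toFun h := if h.length = n then ρ.toFun h else τ.toFun h
  nonneg h s a := by split_ifs <;> [exact ρ.nonneg h s a; exact τ.nonneg h s a]
  support_av h s a ha := by
    split_ifs <;> [exact ρ.support_av h s a ha; exact τ.support_av h s a ha]
  sum_one h s := by split_ifs <;> [exact ρ.sum_one h s; exact τ.sum_one h s]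

/-- The selector prescribed by a strategy after a given history. -/
def selector_s13 (σ : Strategy G p) (h : List G.State) (s : G.State) : Selector G p s where
  toFun := σ.toFun h s
  nonneg := σ.nonneg h s
  support_av := σ.support_av h s
  sum_one := σ.sum_one h s

end Strategy

namespace Game

variable (Gm : Game)

section Profile

variable (π : (p : Gm.Player) → Strategy Gm.toGameStructure p)

lemma stepProb_nonneg (h : List Gm.State) (s t : Gm.State) : 0 ≤ Gm.stepProb π h s t :=
  Finset.sum_nonneg fun _ _ => mul_nonneg
    (Finset.prod_nonneg fun p _ => (π p).nonneg _ _ _) (Gm.trans_nonneg _ _ _)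

lemma sum_stepProb (h : List Gm.State) (s : Gm.State) : ∑ t, Gm.stepProb π h s t = 1 := by
  unfold stepProb
  rw [Finset.sum_comm]
  simp_rw [← Finset.mul_sum, Gm.trans_sum, mul_one]
  rw [← Fintype.prod_sum]
  exact Finset.prod_eq_one fun p _ => (π p).sum_one h s

lemma reachWithin_le_one (n : ℕ) (h : List Gm.State) (s : Gm.State) :
    Gm.reachWithin π n h s ≤ 1 := by
  induction n generalizing h s with
  | zero => unfold reachWithin; split_ifs <;> norm_num
  | succ n ih =>
    unfold reachWithin
    split_ifs
    · exact le_rfl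
    · calc _ ≤ ∑ t, Gm.stepProb π h s t := Finset.sum_le_sum fun t _ =>
            mul_le_of_le_one_right (Gm.stepProb_nonneg π h s t) (ih _ _)
        _ = 1 := Gm.sum_stepProb π h s

lemma bddAbove_range_reachWithin (h : List Gm.State) (s : Gm.State) :
    BddAbove (Set.range fun n => Gm.reachWithin π n h s) :=
  ⟨1, by rintro _ ⟨n, rfl⟩; exact Gm.reachWithin_le_one π n h s⟩

lemma reachWithin_of_mem_target (n : ℕ) (h : List Gm.State) {s : Gm.State}
    (hs : s ∈ Gm.target) : Gm.reachWithin π n h s = 1 := by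
  cases n <;> simp [reachWithin, hs]

end Profile

/-- Probabilities of reaching the target from `h` and from `h'` agree if the two profiles play
alike after all extensions of these histories by a common suffix. -/
lemma reachWithin_congr_append (π π' : (p : Gm.Player) → Strategy Gm.toGameStructure p)
    (h h' : List Gm.State)
    (hπ : ∀ l p, (π p).toFun (h ++ l) = (π' p).toFun (h' ++ l)) (n : ℕ) (l : List Gm.State)
    (s : Gm.State) : Gm.reachWithin π n (h ++ l) s = Gm.reachWithin π' n (h' ++ l) s := by
  induction n generalizing l s with
  | zero => rfl
  | succ n ih => simp only [reachWithin, stepProb, List.append_assoc, ih, hπ]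

lemma combine_toFun_congr {σ σ' : Gm.TeamStrategy} {τ τ' : Gm.OppStrategy}
    {h h' : List Gm.State} (hσ : ∀ p, (σ p).toFun h = (σ' p).toFun h')
    (hτ : ∀ p, (τ p).toFun h = (τ' p).toFun h') (p : Gm.Player) :
    (Gm.combine σ τ p).toFun h = (Gm.combine σ' τ' p).toFun h' := by
  unfold combine
  split_ifs <;> [exact hσ _; exact hτ _]

/-- Against an opponent playing a fixed joint action, the step probabilities are those given by
`succProbTeam`. -/
lemma stepProb_combine_of_pure (σ : Gm.TeamStrategy) (τ : Gm.OppStrategy)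
    (h : List Gm.State) (s : Gm.State) (b : Gm.OppAct)
    (hb : ∀ p a, (τ p).toFun h s a = if a = b p then 1 else 0) (t : Gm.State) :
    Gm.stepProb (Gm.combine σ τ) h s t = Gm.succProbTeam σ h s b t := by
  classical
  unfold stepProb succProbTeam
  have key : ∀ (a : Gm.TeamAct) (c : Gm.OppAct),
      ∏ p, (Gm.combine σ τ p).toFun h s (Gm.combineAct a c p) =
        (∏ p, (σ p).toFun h s (a p)) * if c = b then 1 else 0 := by
    intro a c
    rw [← Fintype.prod_subtype_mul_prod_subtype (fun p => p ∈ Gm.team)]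
    congr 1
    · refine Finset.prod_congr (Finset.ext fun _ => by simp) fun p _ => ?_
      simp [combine, combineAct, p.2]
    · have : ∀ p : Gm.OppPlayer,
          (Gm.combine σ τ p).toFun h s (Gm.combineAct a c p) = if c p = b p then 1 else 0 := by
        intro p
        rw [← hb]
        simp [combine, combineAct, p.2]
      refine (Finset.prod_congr rfl fun p _ => this p).trans ?_
      rw [Fintype.prod_ite_zero]
      simp [funext_iff]
  rw [← (Equiv.piEquivPiSubtypeProd (fun p => p ∈ Gm.team) Gm.Act).symm.sum_comp,
    Fintype.sum_prod_type]
  refine Finset.sum_congr rfl fun a _ => ?_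
  have : ∀ c : Gm.OppAct,
      (Equiv.piEquivPiSubtypeProd (fun p => p ∈ Gm.team) Gm.Act).symm (a, c) =
        Gm.combineAct a c := fun c => rfl
  refine (Finset.sum_congr rfl fun c _ => by rw [this c, key a c]).trans ?_
  simp

/-- The opponent strategy that plays the joint action `choice h s` with probability one. -/
def pureOpp (choice : List Gm.State → Gm.State → Gm.OppAct)
    (hc : ∀ h s, Gm.OppAvailable s (choice h s)) : Gm.OppStrategy :=
  fun p => Strategy.pure (fun h s => choice h s p) fun h s => hc h s p

lemma exists_oppAvailable (s : Gm.State) : ∃ b, Gm.OppAvailable s b :=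
  ⟨fun p => (Gm.av_nonempty p.1 s).choose, fun p => (Gm.av_nonempty p.1 s).choose_spec⟩

lemma exists_pure_oppStrategy (Q : List Gm.State → Gm.State → Gm.OppAct → Prop) :
    ∃ τ : Gm.OppStrategy, ∀ h s, (∃ b, Gm.OppAvailable s b ∧ Q h s b) →
      ∃ b, Gm.OppAvailable s b ∧ Q h s b ∧
        ∀ p a, (τ p).toFun h s a = if a = b p then 1 else 0 := by
  have : ∀ h s, ∃ b, Gm.OppAvailable s b ∧ ((∃ b, Gm.OppAvailable s b ∧ Q h s b) → Q h s b) := by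
    intro h s
    by_cases hQ : ∃ b, Gm.OppAvailable s b ∧ Q h s b
    · obtain ⟨b, hb, hq⟩ := hQ
      exact ⟨b, hb, fun _ => hq⟩
    · obtain ⟨b, hb⟩ := Gm.exists_oppAvailable s
      exact ⟨b, hb, fun h => (hQ h).elim⟩
  choose choice hav hQ using this
  exact ⟨Gm.pureOpp choice hav, fun h s he => ⟨choice h s, hav h s, hQ h s he, fun _ _ => rfl⟩⟩

lemma succProbTeam_nonneg (σ : Gm.TeamStrategy) (h : List Gm.State) (s : Gm.State)
    (b : Gm.OppAct) (t : Gm.State) : 0 ≤ Gm.succProbTeam σ h s b t :=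
  Finset.sum_nonneg fun _ _ => mul_nonneg
    (Finset.prod_nonneg fun p _ => (σ p).nonneg _ _ _) (Gm.trans_nonneg _ _ _)

lemma sum_succProbTeam (σ : Gm.TeamStrategy) (h : List Gm.State) (s : Gm.State)
    (b : Gm.OppAct) : ∑ t, Gm.succProbTeam σ h s b t = 1 := by
  unfold succProbTeam
  rw [Finset.sum_comm]
  simp_rw [← Finset.mul_sum, Gm.trans_sum, mul_one]
  rw [← Fintype.prod_sum]
  exact Finset.prod_eq_one fun p _ => (σ p).sum_one h s

/-- The collective strategy `σ` wins almost surely from `s` after the history `h`. -/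
def WinsAfter (σ : Gm.TeamStrategy) (h : List Gm.State) (s : Gm.State) : Prop :=
  ∀ τ : Gm.OppStrategy, ⨆ n, Gm.reachWithin (Gm.combine σ τ) n h s = 1

variable {Gm}

lemma WinsAfter.mem_winSet {σ : Gm.TeamStrategy} {h : List Gm.State} {s : Gm.State}
    (hw : Gm.WinsAfter σ h s) : s ∈ Gm.winSet := by
  refine ⟨fun p => (σ p).comapHistory (h ++ ·), fun τ => ?_⟩
  rw [reachProbFrom, ← hw fun p => (τ p).comapHistory (List.drop h.length)]
  refine iSup_congr fun n => ?_
  have := Gm.reachWithin_congr_append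
    (Gm.combine σ fun p => (τ p).comapHistory (List.drop h.length))
    (Gm.combine (fun p => (σ p).comapHistory (h ++ ·)) τ) h []
    (fun l => Gm.combine_toFun_congr (fun p => rfl)
      (fun p => by simp [Strategy.comapHistory])) n [] s
  simpa using this.symm

/-- An almost surely winning strategy keeps winning after each step of positive probability. -/
lemma WinsAfter.of_succProbTeam_pos {σ : Gm.TeamStrategy} {h : List Gm.State} {s t : Gm.State}
    (hw : Gm.WinsAfter σ h s) (hs : s ∉ Gm.target) {b : Gm.OppAct}
    (hb : Gm.OppAvailable s b) (ht : 0 < Gm.succProbTeam σ h s b t) :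
    Gm.WinsAfter σ (h ++ [s]) t := by
  intro τ
  have hle : ⨆ n, Gm.reachWithin (Gm.combine σ τ) n (h ++ [s]) t ≤ 1 :=
    ciSup_le fun n => Gm.reachWithin_le_one _ n _ _
  by_contra hne
  have hlt := lt_of_le_of_ne hle hne
  set c := ⨆ n, Gm.reachWithin (Gm.combine σ τ) n (h ++ [s]) t
  obtain ⟨ρ, hρ⟩ := Gm.exists_pure_oppStrategy fun _ s' b' => s' = s → b' = b
  obtain ⟨b', -, hbb, hpure⟩ := hρ h s ⟨b, hb, fun _ => rfl⟩
  obtain rfl := hbb rfl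
  set τ' : Gm.OppStrategy := fun p => (τ p).switchAt (ρ p) h.length
  have hstep : ∀ u, Gm.stepProb (Gm.combine σ τ') h s u = Gm.succProbTeam σ h s b' u :=
    Gm.stepProb_combine_of_pure σ τ' h s b' fun p a => by
      simpa [τ', Strategy.switchAt] using hpure p a
  have hlater : ∀ n u, Gm.reachWithin (Gm.combine σ τ') n (h ++ [s]) u =
      Gm.reachWithin (Gm.combine σ τ) n (h ++ [s]) u := fun n u => by
    simpa using Gm.reachWithin_congr_append (Gm.combine σ τ') (Gm.combine σ τ)
      (h ++ [s]) (h ++ [s])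
      (fun l => Gm.combine_toFun_congr (fun p => rfl)
        (fun p => by simp [τ', Strategy.switchAt])) n [] u
  have hbound : ∀ n, Gm.reachWithin (Gm.combine σ τ') n h s ≤
      1 - Gm.succProbTeam σ h s b' t * (1 - c) := by
    have hp1 : Gm.succProbTeam σ h s b' t ≤ 1 := by
      rw [← Gm.sum_succProbTeam σ h s b']
      exact Finset.single_le_sum (fun u _ => Gm.succProbTeam_nonneg σ h s b' u)
        (Finset.mem_univ t)
    have hc0 : 0 ≤ c := by
      refine le_trans ?_ (le_ciSup (Gm.bddAbove_range_reachWithin _ _ _) 0)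
      unfold reachWithin
      split_ifs <;> norm_num
    rintro (_ | n)
    · rw [reachWithin, if_neg hs]
      nlinarith
    · rw [reachWithin, if_neg hs]
      simp_rw [hstep, hlater]
      rw [le_sub_comm]
      nth_rewrite 2 [← Gm.sum_succProbTeam σ h s b']
      rw [← Finset.sum_sub_distrib]
      simp_rw [← mul_one_sub]
      refine le_trans ?_ (Finset.single_le_sum (fun u _ => ?_) (Finset.mem_univ t))
      · have : Gm.reachWithin (Gm.combine σ τ) n (h ++ [s]) t ≤ c :=
          le_ciSup (Gm.bddAbove_range_reachWithin _ _ _) n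
        gcongr
      · exact mul_nonneg (Gm.succProbTeam_nonneg σ h s b' u)
          (sub_nonneg.2 (Gm.reachWithin_le_one _ n _ u))
  have := hw τ' ▸ ciSup_le hbound
  nlinarith

variable (Gm)

lemma target_subset_winSet : ↑Gm.target ⊆ Gm.winSet := by
  intro s hs
  have hσ : ∃ σ : Gm.TeamStrategy, True :=
    ⟨fun p => Strategy.pure (fun _ s => (Gm.av_nonempty p.1 s).choose)
      fun _ s => (Gm.av_nonempty p.1 s).choose_spec, trivial⟩
  obtain ⟨σ, -⟩ := hσ
  refine ⟨σ, fun τ => ?_⟩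
  simp [reachProbFrom, Gm.reachWithin_of_mem_target _ _ _ hs]

lemma wSeq_subset_succ (k : ℕ) : Gm.wSeq k ⊆ Gm.wSeq (k + 1) := Set.subset_union_left

lemma wSeq_mono : Monotone Gm.wSeq := monotone_nat_of_le_succ Gm.wSeq_subset_succ

lemma wSeq_subset_winSet (k : ℕ) : Gm.wSeq k ⊆ Gm.winSet := by
  induction k with
  | zero => exact Gm.target_subset_winSet
  | succ k ih => exact Set.union_subset ih (Set.sep_subset _ _)

/-- Outside a stable layer, the opponent can keep a winning strategy from entering that layer
in the next step. -/
lemma exists_oppAvailable_avoiding {m : ℕ} (hm : Gm.wSeq (m + 1) ⊆ Gm.wSeq m)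
    {σ : Gm.TeamStrategy} {h : List Gm.State} {s : Gm.State} (hw : Gm.WinsAfter σ h s)
    (hs : s ∉ Gm.wSeq m) :
    ∃ b, Gm.OppAvailable s b ∧ ∀ t ∈ Gm.wSeq m, Gm.succProbTeam σ h s b t = 0 := by
  have hsT : s ∉ Gm.target := fun hT => hs (Gm.wSeq_mono m.zero_le hT)
  by_contra! hcon
  refine hs (hm (Or.inr ⟨hw.mem_winSet, fun p => (σ p).selector_s13 h s, fun b hb => ⟨?_, ?_⟩⟩))
  · obtain ⟨t, htm, ht⟩ := hcon b hb
    refine Finset.sum_pos' (fun u _ => Set.indicator_nonneg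
      (fun u _ => Gm.succProbTeam_nonneg σ h s b u) u) ⟨t, Finset.mem_univ t, ?_⟩
    rw [Set.indicator_of_mem htm]
    exact lt_of_le_of_ne (Gm.succProbTeam_nonneg σ h s b t) ht.symm
  · rw [← Gm.sum_succProbTeam σ h s b]
    refine Finset.sum_congr rfl fun t _ => Set.indicator_apply_eq_self.2 fun ht => ?_
    by_contra hne
    exact ht (hw.of_succProbTeam_pos hsT hb
      (lt_of_le_of_ne (Gm.succProbTeam_nonneg σ h s b t) (Ne.symm hne))).mem_winSet

lemma winSet_subset_wSeq_of_stable {m : ℕ} (hm : Gm.wSeq (m + 1) ⊆ Gm.wSeq m) :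
    Gm.winSet ⊆ Gm.wSeq m := by
  rintro s₀ ⟨σ, hσ⟩
  by_contra hs₀
  obtain ⟨τ, hτ⟩ := Gm.exists_pure_oppStrategy fun h s b =>
    ∀ t ∈ Gm.wSeq m, Gm.succProbTeam σ h s b t = 0
  have hzero : ∀ n h s, Gm.WinsAfter σ h s → s ∉ Gm.wSeq m →
      Gm.reachWithin (Gm.combine σ τ) n h s = 0 := by
    intro n
    induction n with
    | zero =>
      intro h s _ hs
      exact if_neg fun hT => hs (Gm.wSeq_mono m.zero_le hT)
    | succ n ih =>
      intro h s hw hs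
      have hsT : s ∉ Gm.target := fun hT => hs (Gm.wSeq_mono m.zero_le hT)
      obtain ⟨b, hb, hQ, hpure⟩ := hτ h s (Gm.exists_oppAvailable_avoiding hm hw hs)
      rw [reachWithin, if_neg hsT]
      refine Finset.sum_eq_zero fun t _ => ?_
      rw [Gm.stepProb_combine_of_pure σ τ h s b hpure]
      rcases (Gm.succProbTeam_nonneg σ h s b t).eq_or_lt with h0 | hpos
      · rw [← h0, zero_mul]
      · rw [ih _ _ (hw.of_succProbTeam_pos hsT hb hpos) fun ht => hpos.ne' (hQ t ht), mul_zero]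
  have := hσ τ
  simp [reachProbFrom, hzero _ [] s₀ hσ hs₀] at this

end Game

/-- The layered sequence `wSeq` (with `wSeq 0 = target`, and
`wSeq (k+1)` adding the almost-sure winning states from which some collective
selector moves to `wSeq k` with positive probability and stays in the almost-sure
winning set with probability 1, against every available opponent action)
eventually equals the almost-sure winning set. -/
theorem wSeq_reaches_winSet (Gm : Game) : ∃ m : ℕ, Gm.wSeq m = Gm.winSet := by
  obtain ⟨m, hm⟩ := WellFoundedGT.monotone_chain_condition ⟨Gm.wSeq, Gm.wSeq_mono⟩
  exact ⟨m, (Gm.wSeq_subset_winSet m).antisymm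
    (Gm.winSet_subset_wSeq_of_stable (hm (m + 1) m.le_succ).ge)⟩
end
end
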